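/- Let sinc(x) = sin(πx)/(πx) for x ≠ 0 and sinc(0) = 1. Let Ω > 0, b > 0, and let ξ, t ∈ ℝ. If |ξ| < πΩ/b, then the improper integral lim_{R→∞} ∫_{−R}^{R} (Ω/b) · sinc(Ω z / b) · e^{i ξ (t − z)} dz exists and equals e^{i ξ t}; if |ξ| > πΩ/b, the limit exists and equals 0. (Ideal low-pass filtering passes in-band complex exponentials unchanged and annihilates out-of-band ones.) -/

import Mathlib

open Complex Filter

noncomputable section

/-- The normalized sinc function: `sinc x = sin (π x) / (π x)` for `x ≠ 0`, `sinc 0 = 1`. -/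
def sinc (x : ℝ) : ℝ :=
  if x = 0 then 1 else Real.sin (Real.pi * x) / (Real.pi * x)

/-- The sine integral. -/
def sineInt (x : ℝ) : ℝ := ∫ z in (0:ℝ)..x, Real.sinc z

lemma sineInt_inner (R y : ℝ) :
    ∫ x in (0:ℝ)..R, Real.sin x * Real.exp (-x * y) =
      (1 + y ^ 2)⁻¹ -
        Real.exp (-R * y) * ((y * Real.sin R + Real.cos R) * (1 + y ^ 2)⁻¹) := by
  have hy : (1 + y ^ 2) ≠ 0 := by positivity
  have hd : ∀ x ∈ Set.uIcc 0 R, HasDerivAt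
      (fun x : ℝ => -(Real.exp (-x * y) * ((y * Real.sin x + Real.cos x) * (1 + y ^ 2)⁻¹)))
      (Real.sin x * Real.exp (-x * y)) x := by
    intro x _
    have h1 : HasDerivAt (fun x : ℝ => Real.exp (-x * y)) (Real.exp (-x * y) * (-1 * y)) x :=
      (((hasDerivAt_id x).neg).mul_const y).exp
    have h2 : HasDerivAt (fun x : ℝ => (y * Real.sin x + Real.cos x) * (1 + y ^ 2)⁻¹)
        ((y * Real.cos x + -Real.sin x) * (1 + y ^ 2)⁻¹) x :=
      (((Real.hasDerivAt_sin x).const_mul y).add (Real.hasDerivAt_cos x)).mul_const _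
    refine HasDerivAt.congr_deriv (h1.mul h2).neg ?_
    field_simp
    ring
  rw [intervalIntegral.integral_eq_sub_of_hasDerivAt hd
    (Continuous.intervalIntegrable (by fun_prop) _ _)]
  simp
  ring

lemma sineInt_swap {R : ℝ} (hR : 0 < R) :
    sineInt R = ∫ y in Set.Ioi (0:ℝ), ∫ x in (0:ℝ)..R, Real.sin x * Real.exp (-x * y) := by
  have hx : ∀ x ∈ Set.Ioc (0:ℝ) R, Real.sinc x =
      ∫ y in Set.Ioi (0:ℝ), Real.sin x * Real.exp (-x * y) := by
    intro x hx
    rw [MeasureTheory.integral_const_mul, integral_exp_mul_Ioi (by linarith [hx.1]),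
      Real.sinc_of_ne_zero hx.1.ne']
    simp
    ring
  unfold sineInt
  simp_rw [intervalIntegral.integral_of_le hR.le]
  rw [MeasureTheory.setIntegral_congr_fun measurableSet_Ioc hx]
  apply MeasureTheory.integral_integral_swap
  rw [MeasureTheory.integrable_prod_iff]
  · constructor
    · filter_upwards [MeasureTheory.ae_restrict_mem measurableSet_Ioc] with x hx
      have hx0 : -x < 0 := by linarith [hx.1]
      exact (integrableOn_exp_mul_Ioi hx0 0).const_mul (Real.sin x)
    · have hc : MeasureTheory.IntegrableOn (fun x => |Real.sinc x|) (Set.Ioc 0 R) := by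
        have : Continuous (fun x => |Real.sinc x|) := by fun_prop
        exact (this.integrableOn_Icc).mono_set Set.Ioc_subset_Icc_self
      refine hc.congr_fun (fun x hx => ?_) measurableSet_Ioc
      have : ∀ y, ‖Real.sin x * Real.exp (-x * y)‖ = |Real.sin x| * Real.exp (-x * y) := by
        intro y
        rw [norm_mul, Real.norm_eq_abs, Real.norm_eq_abs, Real.abs_exp]
      simp only [Function.uncurry, this]
      rw [MeasureTheory.integral_const_mul, integral_exp_mul_Ioi (by linarith [hx.1]),
        Real.sinc_of_ne_zero hx.1.ne', abs_div, abs_of_pos hx.1]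
      simp
      ring
  · apply Continuous.aestronglyMeasurable
    simp only [Function.uncurry_def]
    fun_prop

lemma sineInt_bound {R : ℝ} (hR : 0 < R) : |sineInt R - Real.pi / 2| ≤ 2 / R := by
  have hb : ∀ y : ℝ, ‖Real.exp (-R * y) *
      ((y * Real.sin R + Real.cos R) * (1 + y ^ 2)⁻¹)‖ ≤ 2 * Real.exp (-R * y) := by
    intro y
    rw [norm_mul, Real.norm_eq_abs, Real.abs_exp, mul_comm]
    gcongr
    have hy : 0 < (1 + y ^ 2) := by positivity
    rw [Real.norm_eq_abs, abs_mul, abs_inv, abs_of_pos hy, ← div_eq_mul_inv, div_le_iff₀ hy]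
    calc |y * Real.sin R + Real.cos R| ≤ |y * Real.sin R| + |Real.cos R| := abs_add_le _ _
      _ ≤ |y| * 1 + 1 := by
        rw [abs_mul]
        gcongr
        · exact Real.abs_sin_le_one R
        · exact Real.abs_cos_le_one R
      _ ≤ 2 * (1 + y ^ 2) := by
        nlinarith [sq_abs y, sq_nonneg (|y| - 1)]
  have hE : MeasureTheory.IntegrableOn (fun y => 2 * Real.exp (-R * y)) (Set.Ioi (0:ℝ)) :=
    (integrableOn_exp_mul_Ioi (by linarith) 0).const_mul 2
  have hI : MeasureTheory.IntegrableOn (fun y => Real.exp (-R * y) *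
      ((y * Real.sin R + Real.cos R) * (1 + y ^ 2)⁻¹)) (Set.Ioi (0:ℝ)) := by
    refine hE.mono' ?_ (Filter.Eventually.of_forall hb)
    apply Continuous.aestronglyMeasurable
    have : ∀ y : ℝ, 1 + y ^ 2 ≠ 0 := fun y => by positivity
    fun_prop (disch := assumption)
  rw [sineInt_swap hR]
  simp_rw [sineInt_inner]
  rw [MeasureTheory.integral_sub integrable_inv_one_add_sq.integrableOn hI,
    integral_Ioi_inv_one_add_sq, Real.arctan_zero, sub_zero, sub_sub_cancel_left, abs_neg,
    ← Real.norm_eq_abs]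
  refine (MeasureTheory.norm_integral_le_of_norm_le hE (Filter.Eventually.of_forall hb)).trans ?_
  rw [MeasureTheory.integral_const_mul, integral_exp_mul_Ioi (by linarith)]
  apply le_of_eq
  simp
  ring

/-- The Dirichlet integral. -/
lemma sineInt_tendsto : Tendsto sineInt atTop (nhds (Real.pi / 2)) := by
  rw [tendsto_iff_norm_sub_tendsto_zero]
  refine squeeze_zero' (Filter.Eventually.of_forall fun _ => norm_nonneg _) ?_
    (tendsto_const_nhds.div_atTop tendsto_id : Tendsto (fun R : ℝ => 2 / R) atTop (nhds 0))
  filter_upwards [eventually_gt_atTop 0] with R hR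
  exact sineInt_bound hR

lemma sineInt_neg (x : ℝ) : sineInt (-x) = - sineInt x := by
  unfold sineInt
  have := intervalIntegral.integral_comp_neg (a := 0) (b := x) (fun z => Real.sinc z)
  simp only [Real.sinc_neg, neg_zero] at this
  rw [this, intervalIntegral.integral_symm]

lemma sineInt_pos_mul {a : ℝ} (ha : 0 < a) :
    Tendsto (fun R => sineInt (a * R)) atTop (nhds (Real.pi / 2)) :=
  sineInt_tendsto.comp (tendsto_id.const_mul_atTop ha)

lemma sineInt_neg_mul {a : ℝ} (ha : a < 0) :
    Tendsto (fun R => sineInt (a * R)) atTop (nhds (-(Real.pi / 2))) := by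
  have := (sineInt_pos_mul (neg_pos.mpr ha)).neg
  refine this.congr fun R => ?_
  rw [← sineInt_neg]
  congr 1
  ring

lemma sinc_eq_real (x : ℝ) : sinc x = Real.sinc (Real.pi * x) := by
  by_cases hx : x = 0
  · simp [sinc, hx]
  · rw [Real.sinc_of_ne_zero (mul_ne_zero Real.pi_ne_zero hx)]
    simp [sinc, hx]

lemma sinc_product (W ξ z : ℝ) :
    2 * W * Real.sinc (W * z) * Real.cos (ξ * z) =
      (W + ξ) * Real.sinc ((W + ξ) * z) + (W - ξ) * Real.sinc ((W - ξ) * z) := by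
  have key : ∀ a : ℝ, z ≠ 0 → a * Real.sinc (a * z) = Real.sin (a * z) / z := by
    intro a hz
    by_cases ha : a = 0
    · simp [ha]
    · rw [Real.sinc_of_ne_zero (mul_ne_zero ha hz)]
      field_simp
  by_cases hz : z = 0
  · simp [hz]
    ring
  · rw [key _ hz, key _ hz, mul_assoc 2, key _ hz, add_mul, sub_mul, Real.sin_add, Real.sin_sub]
    ring

lemma lowpass_integral (Ω b ξ t R : ℝ) :
    (∫ z in (-R)..R, ((Ω / b : ℝ) : ℂ) * ((sinc (Ω * z / b) : ℝ) : ℂ) *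
            Complex.exp (Complex.I * (ξ : ℂ) * ((t : ℂ) - (z : ℂ)))) =
      Complex.exp (Complex.I * (ξ : ℂ) * (t : ℂ)) *
        (((sineInt ((Real.pi * Ω / b + ξ) * R) + sineInt ((Real.pi * Ω / b - ξ) * R)) / Real.pi
          : ℝ) : ℂ) := by
  set W := Real.pi * Ω / b with hW
  set f : ℝ → ℂ := fun z => ((Ω / b : ℝ) : ℂ) * ((sinc (Ω * z / b) : ℝ) : ℂ) *
            Complex.exp (Complex.I * (ξ : ℂ) * ((t : ℂ) - (z : ℂ))) with hf
  have hs : ∀ z, sinc (Ω * z / b) = Real.sinc (W * z) := by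
    intro z
    rw [sinc_eq_real, hW]
    congr 1
    ring
  have hc : Continuous f := by
    simp only [hf, hs]
    fun_prop
  have hfi : ∀ u v, IntervalIntegrable f MeasureTheory.volume u v := fun u v =>
    hc.intervalIntegrable u v
  have hneg : (∫ z in (-R)..0, f z) = ∫ z in (0:ℝ)..R, f (-z) := by
    rw [intervalIntegral.integral_comp_neg, neg_zero]
  have hsum : ∀ z, f (-z) + f z = Complex.exp (Complex.I * (ξ : ℂ) * (t : ℂ)) *
      ((((W + ξ) * Real.sinc ((W + ξ) * z) + (W - ξ) * Real.sinc ((W - ξ) * z)) / Real.pi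
        : ℝ) : ℂ) := by
    intro z
    rw [← sinc_product]
    simp only [hf, hs, mul_neg, Real.sinc_neg]
    have hΩ : Ω / b = W / Real.pi := by
      rw [hW]
      field_simp
    have e1 : Complex.I * (ξ : ℂ) * ((t : ℂ) - ((-z : ℝ) : ℂ)) =
        Complex.I * ξ * t + ((ξ * z : ℝ) : ℂ) * Complex.I := by
      push_cast
      ring
    have e2 : Complex.I * (ξ : ℂ) * ((t : ℂ) - (z : ℂ)) =
        Complex.I * ξ * t + (-((ξ * z : ℝ) : ℂ)) * Complex.I := by
      push_cast
      ring
    have e3 : (((2 * W * Real.sinc (W * z) * Real.cos (ξ * z)) / Real.pi : ℝ) : ℂ) =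
        ((W / Real.pi : ℝ) : ℂ) * (Real.sinc (W * z) : ℂ) *
          (2 * Complex.cos ((ξ * z : ℝ) : ℂ)) := by
      rw [← Complex.ofReal_cos]
      push_cast
      ring
    rw [e1, e2, e3, hΩ, Complex.exp_add, Complex.exp_add, Complex.two_cos]
    ring
  have hS : ∀ a : ℝ, ∫ z in (0:ℝ)..R, a * Real.sinc (a * z) = sineInt (a * R) := by
    intro a
    rw [intervalIntegral.integral_const_mul, intervalIntegral.mul_integral_comp_mul_left,
      mul_zero, sineInt]
  have hfi' : IntervalIntegrable (fun z => f (-z)) MeasureTheory.volume 0 R :=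
    (hc.comp continuous_neg).intervalIntegrable _ _
  rw [← intervalIntegral.integral_add_adjacent_intervals (hfi (-R) 0) (hfi 0 R), hneg,
    ← intervalIntegral.integral_add hfi' (hfi 0 R)]
  simp_rw [hsum]
  rw [intervalIntegral.integral_const_mul, intervalIntegral.integral_ofReal,
    intervalIntegral.integral_div, intervalIntegral.integral_add, hS, hS]
  · exact Continuous.intervalIntegrable (by fun_prop) _ _
  · exact Continuous.intervalIntegrable (by fun_prop) _ _

/-- **Ideal low-pass filtering of complex exponentials.**  For `|ξ| < πΩ/b` the improper
integral `lim_{R→∞} ∫_{-R}^R (Ω/b) sinc (Ω z/b) e^{i ξ (t - z)} dz` exists and equals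
`e^{i ξ t}`; for `|ξ| > πΩ/b` it exists and equals `0`. -/
theorem lowpass_of_exponential (Ω b : ℝ) (hΩ : 0 < Ω) (hb : 0 < b) (ξ t : ℝ) :
    (|ξ| < Real.pi * Ω / b →
      Tendsto (fun R : ℝ => ∫ z in (-R)..R,
          ((Ω / b : ℝ) : ℂ) * ((sinc (Ω * z / b) : ℝ) : ℂ) *
            Complex.exp (Complex.I * (ξ : ℂ) * ((t : ℂ) - (z : ℂ))))
        atTop (nhds (Complex.exp (Complex.I * (ξ : ℂ) * (t : ℂ))))) ∧
    (Real.pi * Ω / b < |ξ| →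
      Tendsto (fun R : ℝ => ∫ z in (-R)..R,
          ((Ω / b : ℝ) : ℂ) * ((sinc (Ω * z / b) : ℝ) : ℂ) *
            Complex.exp (Complex.I * (ξ : ℂ) * ((t : ℂ) - (z : ℂ))))
        atTop (nhds 0)) := by
  simp_rw [lowpass_integral]
  set W := Real.pi * Ω / b with hW
  have hW0 : 0 < W := by positivity
  have main : ∀ l₁ l₂ : ℝ, Tendsto (fun R => sineInt ((W + ξ) * R)) atTop (nhds l₁) →
      Tendsto (fun R => sineInt ((W - ξ) * R)) atTop (nhds l₂) →
      Tendsto (fun R : ℝ => Complex.exp (Complex.I * (ξ : ℂ) * (t : ℂ)) *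
        (((sineInt ((W + ξ) * R) + sineInt ((W - ξ) * R)) / Real.pi : ℝ) : ℂ)) atTop
        (nhds (Complex.exp (Complex.I * (ξ : ℂ) * (t : ℂ)) *
          (((l₁ + l₂) / Real.pi : ℝ) : ℂ))) := by
    intro l₁ l₂ h₁ h₂
    exact (((Complex.continuous_ofReal.tendsto _).comp
      ((h₁.add h₂).div_const Real.pi))).const_mul _
  constructor
  · intro h
    have h' := abs_lt.mp h
    have := main _ _ (sineInt_pos_mul (by linarith)) (sineInt_pos_mul (by linarith))
    rwa [add_halves, div_self Real.pi_ne_zero, Complex.ofReal_one, mul_one] at this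
  · intro h
    rcases lt_abs.mp h with h' | h'
    · have := main _ _ (sineInt_pos_mul (by linarith)) (sineInt_neg_mul (by linarith))
      rwa [add_neg_cancel, zero_div, Complex.ofReal_zero, mul_zero] at this
    · have := main _ _ (sineInt_neg_mul (by linarith)) (sineInt_pos_mul (by linarith))
      rwa [neg_add_cancel, zero_div, Complex.ofReal_zero, mul_zero] at this
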